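/- Let D be a type of transaction data and let blocks be pairs in D × ℕ whose second component is the stored previous-hash field. Let H : D × ℕ → ℕ be injective. Suppose c, c' : Fin (n+1) → D × ℕ are both hash-valid chains, i.e. (c i.succ).2 = H (c i.castSucc) and (c' i.succ).2 = H (c' i.castSucc) for all i : Fin n. If the chains agree on their final block, c (Fin.last n) = c' (Fin.last n), then they agree everywhere: c i = c' i for all i : Fin (n+1). -/

import Mathlib

/-- Immutability: two hash-valid chains (blocks are (data, prevHash) pairs)
that agree on their final block agree everywhere. -/
theorem final_block_determines_history {D : Type*} (H : D × ℕ → ℕ)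
    (hH : Function.Injective H) {n : ℕ} (c c' : Fin (n + 1) → D × ℕ)
    (hc : ∀ i : Fin n, (c i.succ).2 = H (c i.castSucc))
    (hc' : ∀ i : Fin n, (c' i.succ).2 = H (c' i.castSucc))
    (hlast : c (Fin.last n) = c' (Fin.last n)) :
    ∀ i : Fin (n + 1), c i = c' i := by
  intro i
  induction i using Fin.reverseInduction with
  | last => exact hlast
  | cast i ih => exact hH (by rw [← hc, ← hc', ih])
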